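/- arXiv:math/0003037 — 3 statements merged into one kernel-verified Lean document; each statement's English description precedes it below -/
import Mathlib

section
/- Let τ0 ∈ (a,b) with G'(τ0) = 0, and let ε > 0 with τ0 + ε < b. Then for every sequence (D_n) of real numbers with D_n increasing to G(τ0) and with G(τ) > D_n for all τ ∈ (τ0, τ0 + ε] and all n, one has ∫_{τ0}^{τ0+ε} f(τ)^{−2} (G(τ) − D_n)^{−1/2} dτ → ∞ as n → ∞. -/
open Set Filter MeasureTheory Topology
open scoped ENNReal NNReal

noncomputable section

namespace GRW

/-- The open interval `(a,b)` (extended-real endpoints) as a subset of `ℝ`. -/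
def II (aE bE : EReal) : Set ℝ := {τ : ℝ | aE < (τ : EReal) ∧ (τ : EReal) < bE}

/-- `G = 1/f²`. -/
def G (f : ℝ → ℝ) (τ : ℝ) : ℝ := ((f τ) ^ 2)⁻¹

/-- The nonnegative integrand `f⁻² (G − D)^{-1/2}`, valued in `[0,∞]`. -/
def h (f : ℝ → ℝ) (D τ : ℝ) : ℝ≥0∞ :=
  ENNReal.ofReal ((f τ ^ 2 * Real.sqrt (G f τ - D))⁻¹)

/-- A geodesic `t ↦ (σ t, x t)` of `g^f = -dτ² + f(τ)² dx²` defined on `[t0, t1]`,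
with values in the spacetime `(a,b) × J`. -/
structure IsGeodesicOn (aE bE : EReal) (f : ℝ → ℝ) (J : Set ℝ)
    (σ x : ℝ → ℝ) (t0 t1 : ℝ) : Prop where
  mem_base : ∀ t ∈ Icc t0 t1, σ t ∈ II aE bE
  mem_fiber : ∀ t ∈ Icc t0 t1, x t ∈ J
  smooth_base : ContDiffOn ℝ 2 σ (Icc t0 t1)
  smooth_fiber : ContDiffOn ℝ 2 x (Icc t0 t1)
  eq_base : ∀ t ∈ Icc t0 t1,
    derivWithin (derivWithin σ (Icc t0 t1)) (Icc t0 t1) t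
      = -(f (σ t) * deriv f (σ t) * (derivWithin x (Icc t0 t1) t) ^ 2)
  eq_fiber : ∀ t ∈ Icc t0 t1,
    derivWithin (derivWithin x (Icc t0 t1)) (Icc t0 t1) t
      = -(2 * (deriv f (σ t) / f (σ t)) * derivWithin σ (Icc t0 t1) t
          * derivWithin x (Icc t0 t1) t)

/-- The energy `-(τ')² + f(τ)² (x')²` of a curve `(σ, x)` parameterized on `[t0,t1]`. -/
def energyW (f σ x : ℝ → ℝ) (t0 t1 t : ℝ) : ℝ :=
  -(derivWithin σ (Icc t0 t1) t) ^ 2 + (f (σ t)) ^ 2 * (derivWithin x (Icc t0 t1) t) ^ 2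

/-- The velocity of a curve `(σ, x)` parameterized on `[t0,t1]`. -/
def velW (σ x : ℝ → ℝ) (t0 t1 t : ℝ) : ℝ × ℝ :=
  (derivWithin σ (Icc t0 t1) t, derivWithin x (Icc t0 t1) t)

/-- Geodesic connectedness of the GRW spacetime `(a,b) × J`. -/
def GeodConnected (aE bE : EReal) (f : ℝ → ℝ) (J : Set ℝ) : Prop :=
  ∀ τ0 x0 τ0' x0' : ℝ, τ0 ∈ II aE bE → x0 ∈ J → τ0' ∈ II aE bE → x0' ∈ J →
    ∃ (σ x : ℝ → ℝ) (t1 : ℝ), 0 ≤ t1 ∧ IsGeodesicOn aE bE f J σ x 0 t1 ∧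
      σ 0 = τ0 ∧ x 0 = x0 ∧ σ t1 = τ0' ∧ x t1 = x0'

/-- Two points are related by a piecewise-`C¹` curve in the spacetime all of whose pieces
satisfy the pointwise condition `P` on (energy density, velocity). -/
def RelatedVia (aE bE : EReal) (f : ℝ → ℝ) (J : Set ℝ)
    (P : ℝ → ℝ × ℝ → Prop) (z z' : ℝ × ℝ) : Prop :=
  ∃ (n : ℕ) (s : ℕ → ℝ) (σ x : ℝ → ℝ),
    s 0 = 0 ∧ s (n + 1) = 1 ∧ (∀ i ≤ n, s i < s (i + 1)) ∧
    σ 0 = z.1 ∧ x 0 = z.2 ∧ σ 1 = z'.1 ∧ x 1 = z'.2 ∧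
    (∀ t ∈ Icc (0:ℝ) 1, σ t ∈ II aE bE ∧ x t ∈ J) ∧
    ContinuousOn σ (Icc 0 1) ∧ ContinuousOn x (Icc 0 1) ∧
    ∀ i ≤ n, ContDiffOn ℝ 1 σ (Icc (s i) (s (i + 1))) ∧
      ContDiffOn ℝ 1 x (Icc (s i) (s (i + 1))) ∧
      ∀ t ∈ Icc (s i) (s (i + 1)),
        P (energyW f σ x (s i) (s (i + 1)) t) (velW σ x (s i) (s (i + 1)) t)

/-- Timelike related: joined by a piecewise smooth timelike curve. -/
def TimelikeRel (aE bE : EReal) (f : ℝ → ℝ) (J : Set ℝ) (z z' : ℝ × ℝ) : Prop :=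
  RelatedVia aE bE f J (fun q _ => q < 0) z z'

/-- Spacelike related: joined by a piecewise smooth spacelike curve. -/
def SpacelikeRel (aE bE : EReal) (f : ℝ → ℝ) (J : Set ℝ) (z z' : ℝ × ℝ) : Prop :=
  RelatedVia aE bE f J (fun q _ => 0 < q) z z'

/-- Lightlike related: joined by a piecewise smooth lightlike curve with
nowhere-vanishing velocity. -/
def LightlikeRel (aE bE : EReal) (f : ℝ → ℝ) (J : Set ℝ) (z z' : ℝ × ℝ) : Prop :=
  RelatedVia aE bE f J (fun q v => q = 0 ∧ v ≠ 0) z z'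

/-- The filter of approach to `b` from inside `(a,b)`. -/
def Fb (bE : EReal) : Filter ℝ := comap (fun τ : ℝ => (τ : EReal)) (𝓝[<] bE)

/-- The filter of approach to `a` from inside `(a,b)`. -/
def Fa (aE : EReal) : Filter ℝ := comap (fun τ : ℝ => (τ : EReal)) (𝓝[>] aE)

/-- `m_b = liminf_{τ→b} G(τ)`, valued in `EReal`. -/
def mB (bE : EReal) (f : ℝ → ℝ) : EReal := liminf (fun τ => (G f τ : EReal)) (Fb bE)

/-- `m_a = liminf_{τ→a} G(τ)`, valued in `EReal`. -/
def mA (aE : EReal) (f : ℝ → ℝ) : EReal := liminf (fun τ => (G f τ : EReal)) (Fa aE)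

/-- `c` witnesses that `G` reaches a relative minimum at `b`: `G > m_b` on `(c,b)`. -/
def RelMinB (aE bE : EReal) (f : ℝ → ℝ) (c : ℝ) : Prop :=
  c ∈ II aE bE ∧ ∀ τ : ℝ, c < τ → (τ : EReal) < bE → mB bE f < (G f τ : EReal)

/-- `c` witnesses that `G` reaches a relative minimum at `a`: `G > m_a` on `(a,c)`. -/
def RelMinA (aE bE : EReal) (f : ℝ → ℝ) (c : ℝ) : Prop :=
  c ∈ II aE bE ∧ ∀ τ : ℝ, τ < c → aE < (τ : EReal) → mA aE f < (G f τ : EReal)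

/-- `∫_c^b f⁻²(G−D)^{-1/2}`, valued in `[0,∞]`. -/
def IbInt (bE : EReal) (f : ℝ → ℝ) (c D : ℝ) : ℝ≥0∞ :=
  ∫⁻ τ in {τ : ℝ | c < τ ∧ (τ : EReal) < bE}, h f D τ

/-- `∫_a^c f⁻²(G−D)^{-1/2}`, valued in `[0,∞]`. -/
def IaInt (aE : EReal) (f : ℝ → ℝ) (c D : ℝ) : ℝ≥0∞ :=
  ∫⁻ τ in {τ : ℝ | aE < (τ : EReal) ∧ τ < c}, h f D τ

/-- Condition (A) at `b`. -/
def CondA_b (aE bE : EReal) (f : ℝ → ℝ) : Prop :=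
  (¬ ∃ c, RelMinB aE bE f c) ∨
  ∃ c, RelMinB aE bE f c ∧ IbInt bE f c (mB bE f).toReal = ⊤

/-- Condition (A) at `a`. -/
def CondA_a (aE bE : EReal) (f : ℝ → ℝ) : Prop :=
  (¬ ∃ c, RelMinA aE bE f c) ∨
  ∃ c, RelMinA aE bE f c ∧ IaInt aE f c (mA aE f).toReal = ⊤

/-- Condition (A). -/
def CondA (aE bE : EReal) (f : ℝ → ℝ) : Prop :=
  CondA_a aE bE f ∧ CondA_b aE bE f

/-- `b^*(D) = inf {τ ∈ (c,b) | G τ = D}`, defaulting to `b` when the set is empty. -/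
def bstar (bE : EReal) (f : ℝ → ℝ) (c D : ℝ) : EReal :=
  sInf (insert bE ((fun τ : ℝ => (τ : EReal)) ''
    {τ : ℝ | c < τ ∧ (τ : EReal) < bE ∧ G f τ = D}))

/-- `a^*(D) = sup {τ ∈ (a,c) | G τ = D}`, defaulting to `a` when the set is empty. -/
def astar (aE : EReal) (f : ℝ → ℝ) (c D : ℝ) : EReal :=
  sSup (insert aE ((fun τ : ℝ => (τ : EReal)) ''
    {τ : ℝ | τ < c ∧ aE < (τ : EReal) ∧ G f τ = D}))

/-- `∫_c^{b^*(D)} f⁻²(G−D)^{-1/2}`. -/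
def IbStar (bE : EReal) (f : ℝ → ℝ) (c D : ℝ) : ℝ≥0∞ :=
  ∫⁻ τ in {τ : ℝ | c < τ ∧ (τ : EReal) < bstar bE f c D}, h f D τ

/-- `∫_{a^*(D)}^c f⁻²(G−D)^{-1/2}`. -/
def IaStar (aE : EReal) (f : ℝ → ℝ) (c D : ℝ) : ℝ≥0∞ :=
  ∫⁻ τ in {τ : ℝ | astar aE f c D < (τ : EReal) ∧ τ < c}, h f D τ

/-- `d_b`, computed with respect to the cut point `c`. -/
def dB (bE : EReal) (f : ℝ → ℝ) (c : ℝ) : ℝ≥0∞ :=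
  limsup (fun D => IbStar bE f c D) (𝓝[>] (mB bE f).toReal) - IbInt bE f c (mB bE f).toReal

/-- `d_a`, computed with respect to the cut point `c`. -/
def dA (aE : EReal) (f : ℝ → ℝ) (c : ℝ) : ℝ≥0∞ :=
  limsup (fun D => IaStar aE f c D) (𝓝[>] (mA aE f).toReal) - IaInt aE f c (mA aE f).toReal

/-- Condition (B) at `b`. -/
def CondB_b (aE bE : EReal) (f : ℝ → ℝ) (J : Set ℝ) : Prop :=
  CondA_b aE bE f ∨ ∃ c, RelMinB aE bE f c ∧ EMetric.diam J ≤ 2 * dB bE f c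

/-- Condition (B) at `a`. -/
def CondB_a (aE bE : EReal) (f : ℝ → ℝ) (J : Set ℝ) : Prop :=
  CondA_a aE bE f ∨ ∃ c, RelMinA aE bE f c ∧ EMetric.diam J ≤ 2 * dA aE f c

/-- Condition (B). -/
def CondB (aE bE : EReal) (f : ℝ → ℝ) (J : Set ℝ) : Prop :=
  CondB_a aE bE f J ∧ CondB_b aE bE f J

/-- `m = inf_{(a,b)} G`. -/
def mGlob (aE bE : EReal) (f : ℝ → ℝ) : ℝ := sInf (G f '' II aE bE)

/-- `α(D) = sup {τ ∈ (a,b) | G τ = D}`. -/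
def alphaD (aE bE : EReal) (f : ℝ → ℝ) (D : ℝ) : EReal :=
  sSup ((fun τ : ℝ => (τ : EReal)) '' {τ : ℝ | τ ∈ II aE bE ∧ G f τ = D})

/-- `β(D) = inf {τ ∈ (a,b) | G τ = D}`. -/
def betaD (aE bE : EReal) (f : ℝ → ℝ) (D : ℝ) : EReal :=
  sInf ((fun τ : ℝ => (τ : EReal)) '' {τ : ℝ | τ ∈ II aE bE ∧ G f τ = D})

/-- `i_b = inf_{D ∈ (m, m_b)} ∫_{α(D)}^b f⁻²(G−D)^{-1/2}`. -/
def iB (aE bE : EReal) (f : ℝ → ℝ) : ℝ≥0∞ :=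
  ⨅ D ∈ Ioo (mGlob aE bE f) (mB bE f).toReal,
    ∫⁻ τ in {τ : ℝ | alphaD aE bE f D < (τ : EReal) ∧ (τ : EReal) < bE}, h f D τ

/-- `i_a = inf_{D ∈ (m, m_a)} ∫_a^{β(D)} f⁻²(G−D)^{-1/2}`. -/
def iA (aE bE : EReal) (f : ℝ → ℝ) : ℝ≥0∞ :=
  ⨅ D ∈ Ioo (mGlob aE bE f) (mA aE f).toReal,
    ∫⁻ τ in {τ : ℝ | aE < (τ : EReal) ∧ (τ : EReal) < betaD aE bE f D}, h f D τ

/-- Condition (C) at `b`. -/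
def CondC_b (aE bE : EReal) (f : ℝ → ℝ) (J : Set ℝ) : Prop :=
  CondB_b aE bE f J ∨
    ((mGlob aE bE f : EReal) < mB bE f ∧ ∃ c, RelMinB aE bE f c ∧ iB aE bE f ≤ dB bE f c)

/-- Condition (C) at `a`. -/
def CondC_a (aE bE : EReal) (f : ℝ → ℝ) (J : Set ℝ) : Prop :=
  CondB_a aE bE f J ∨
    ((mGlob aE bE f : EReal) < mA aE f ∧ ∃ c, RelMinA aE bE f c ∧ iA aE bE f ≤ dA aE f c)

/-- Condition (C). -/
def CondC (aE bE : EReal) (f : ℝ → ℝ) (J : Set ℝ) : Prop :=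
  CondC_a aE bE f J ∧ CondC_b aE bE f J

/-! ### Condition (R) -/

/-- `b^*(D) = inf {τ ∈ [τ0, b) | G τ = D}` (defaulting to `b`). -/
def bstarR (bE : EReal) (f : ℝ → ℝ) (τ0 D : ℝ) : EReal :=
  sInf (insert bE ((fun τ : ℝ => (τ : EReal)) ''
    {τ : ℝ | τ0 ≤ τ ∧ (τ : EReal) < bE ∧ G f τ = D}))

/-- `a^*(D) = sup {τ ∈ (a, τ0] | G τ = D}` (defaulting to `a`). -/
def astarR (aE : EReal) (f : ℝ → ℝ) (τ0 D : ℝ) : EReal :=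
  sSup (insert aE ((fun τ : ℝ => (τ : EReal)) ''
    {τ : ℝ | τ ≤ τ0 ∧ aE < (τ : EReal) ∧ G f τ = D}))

/-- `A(D) = ∫_{a^*(D)}^{τ0} h_D`. -/
def AInt (aE : EReal) (f : ℝ → ℝ) (τ0 D : ℝ) : ℝ≥0∞ :=
  ∫⁻ τ in {τ : ℝ | astarR aE f τ0 D < (τ : EReal) ∧ τ < τ0}, h f D τ

/-- `B(D) = ∫_{τ0}^{b^*(D)} h_D`. -/
def BInt (bE : EReal) (f : ℝ → ℝ) (τ0 D : ℝ) : ℝ≥0∞ :=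
  ∫⁻ τ in {τ : ℝ | τ0 < τ ∧ (τ : EReal) < bstarR bE f τ0 D}, h f D τ

/-- `T(D) = ∫_{a^*(D)}^{b^*(D)} h_D`. -/
def TInt (aE bE : EReal) (f : ℝ → ℝ) (τ0 D : ℝ) : ℝ≥0∞ :=
  ∫⁻ τ in {τ : ℝ | astarR aE f τ0 D < (τ : EReal) ∧ (τ : EReal) < bstarR bE f τ0 D},
    h f D τ

/-- The point `b − ε` (replaced by `1/ε` when `b = ∞`). -/
def bEnd (bE : EReal) (ε : ℝ) : ℝ := if bE = ⊤ then ε⁻¹ else bE.toReal - ε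

/-- The point `a + ε` (replaced by `−1/ε` when `a = −∞`). -/
def aEnd (aE : EReal) (ε : ℝ) : ℝ := if aE = ⊥ then -ε⁻¹ else aE.toReal + ε

/-- The oriented integral `Q(D,ε) = ∫_{b−ε}^{b^*(D)} h_D`, valued in `[−∞,∞]`. -/
def QInt (bE : EReal) (f : ℝ → ℝ) (τ0 D ε : ℝ) : EReal :=
  if ((bEnd bE ε : ℝ) : EReal) ≤ bstarR bE f τ0 D then
    ((∫⁻ τ in {τ : ℝ | bEnd bE ε < τ ∧ (τ : EReal) < bstarR bE f τ0 D}, h f D τ : ℝ≥0∞) :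
      EReal)
  else
    -((∫⁻ τ in {τ : ℝ | bstarR bE f τ0 D < (τ : EReal) ∧ τ < bEnd bE ε}, h f D τ : ℝ≥0∞) :
      EReal)

/-- The oriented integral `Q'(D,ε) = ∫_{a^*(D)}^{a+ε} h_D`, valued in `[−∞,∞]`. -/
def QInt' (aE : EReal) (f : ℝ → ℝ) (τ0 D ε : ℝ) : EReal :=
  if astarR aE f τ0 D ≤ ((aEnd aE ε : ℝ) : EReal) then
    ((∫⁻ τ in {τ : ℝ | astarR aE f τ0 D < (τ : EReal) ∧ τ < aEnd aE ε}, h f D τ : ℝ≥0∞) :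
      EReal)
  else
    -((∫⁻ τ in {τ : ℝ | aEnd aE ε < τ ∧ (τ : EReal) < astarR aE f τ0 D}, h f D τ : ℝ≥0∞) :
      EReal)

/-- `C_n(D)`: `B(D)` for even `n`, `A(D)` for odd `n`. -/
def CInt (aE bE : EReal) (f : ℝ → ℝ) (τ0 : ℝ) (n : ℕ) (D : ℝ) : ℝ≥0∞ :=
  if Even n then BInt bE f τ0 D else AInt aE f τ0 D

/-- `C'_n(D)`: `A(D)` for even `n`, `B(D)` for odd `n`. -/
def CInt' (aE bE : EReal) (f : ℝ → ℝ) (τ0 : ℝ) (n : ℕ) (D : ℝ) : ℝ≥0∞ :=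
  if Even n then AInt aE f τ0 D else BInt bE f τ0 D

/-- `r_i^n(τ0) = lim_{ε↘0} liminf_{D↘m} (C_n(D) + n·T(D) − Q(D,ε))`; since the inner
quantity is nonincreasing in `ε`, the limit as `ε ↘ 0` is the supremum over `ε > 0`. -/
def rI (aE bE : EReal) (f : ℝ → ℝ) (τ0 : ℝ) (n : ℕ) : EReal :=
  ⨆ ε : {e : ℝ // 0 < e},
    liminf (fun D =>
        ((CInt aE bE f τ0 n D + n * TInt aE bE f τ0 D : ℝ≥0∞) : EReal)
          - QInt bE f τ0 D ε.1)
      (𝓝[>] (mGlob aE bE f))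

/-- `r_s^n(τ0) = lim_{ε↘0} limsup_{D↘m} (C_n(D) + n·T(D) + Q(D,ε))`. -/
def rS (aE bE : EReal) (f : ℝ → ℝ) (τ0 : ℝ) (n : ℕ) : EReal :=
  ⨅ ε : {e : ℝ // 0 < e},
    limsup (fun D =>
        ((CInt aE bE f τ0 n D + n * TInt aE bE f τ0 D : ℝ≥0∞) : EReal)
          + QInt bE f τ0 D ε.1)
      (𝓝[>] (mGlob aE bE f))

/-- `l_i^n(τ0) = lim_{ε↘0} liminf_{D↘m} (C'_n(D) + n·T(D) − Q'(D,ε))`. -/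
def lI (aE bE : EReal) (f : ℝ → ℝ) (τ0 : ℝ) (n : ℕ) : EReal :=
  ⨆ ε : {e : ℝ // 0 < e},
    liminf (fun D =>
        ((CInt' aE bE f τ0 n D + n * TInt aE bE f τ0 D : ℝ≥0∞) : EReal)
          - QInt' aE f τ0 D ε.1)
      (𝓝[>] (mGlob aE bE f))

/-- `l_s^n(τ0) = lim_{ε↘0} limsup_{D↘m} (C'_n(D) + n·T(D) + Q'(D,ε))`. -/
def lS (aE bE : EReal) (f : ℝ → ℝ) (τ0 : ℝ) (n : ℕ) : EReal :=
  ⨅ ε : {e : ℝ // 0 < e},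
    limsup (fun D =>
        ((CInt' aE bE f τ0 n D + n * TInt aE bE f τ0 D : ℝ≥0∞) : EReal)
          + QInt' aE f τ0 D ε.1)
      (𝓝[>] (mGlob aE bE f))

/-- Condition (R). -/
def CondR (aE bE : EReal) (f : ℝ → ℝ) (J : Set ℝ) : Prop :=
  (∀ τ ∈ II aE bE, mGlob aE bE f < G f τ) ∧
  mA aE f = (mGlob aE bE f : EReal) ∧ mB bE f = (mGlob aE bE f : EReal) ∧
  ∀ τ0 ∈ II aE bE,
    (Icc (rI aE bE f τ0 0) ((EMetric.diam J : ℝ≥0∞) : EReal) ⊆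
        ⋃ n : ℕ, Icc (rI aE bE f τ0 n) (rS aE bE f τ0 n)) ∧
    (Icc (lI aE bE f τ0 0) ((EMetric.diam J : ℝ≥0∞) : EReal) ⊆
        ⋃ n : ℕ, Icc (lI aE bE f τ0 n) (lS aE bE f τ0 n))

end GRW

open Set Filter MeasureTheory Topology GRW
open scoped ENNReal

/-- If `G'(τ0) = 0` and `τ0 + ε < b`, then for every sequence `(D_n)`
increasing to `G(τ0)` with `G > D_n` on `(τ0, τ0 + ε]`, the integrals
`∫_{τ0}^{τ0+ε} f⁻²(G−D_n)^{-1/2}` tend to `∞`. -/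
theorem integral_tendsto_top_of_deriv_zero
    (aE bE : EReal) (hab : aE < bE) (f : ℝ → ℝ)
    (hf : ContDiffOn ℝ (⊤ : ℕ∞) f (II aE bE)) (hfpos : ∀ τ ∈ II aE bE, 0 < f τ)
    (τ0 : ℝ) (hτ0 : τ0 ∈ II aE bE) (hG' : deriv (G f) τ0 = 0)
    (ε : ℝ) (hε : 0 < ε) (hεb : ((τ0 + ε : ℝ) : EReal) < bE)
    (Dn : ℕ → ℝ) (hmono : StrictMono Dn)
    (hlim : Tendsto Dn atTop (𝓝 (G f τ0)))
    (hlt : ∀ n, ∀ τ ∈ Ioc τ0 (τ0 + ε), Dn n < G f τ) :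
    Tendsto (fun n => ∫⁻ τ in Ioc τ0 (τ0 + ε), h f (Dn n) τ) atTop (𝓝 ⊤) := by
  have hopen : IsOpen (II aE bE) := by
    have h1 : II aE bE = (fun τ : ℝ => (τ : EReal)) ⁻¹' (Ioo aE bE) := rfl
    rw [h1]
    exact isOpen_Ioo.preimage continuous_coe_real_ereal
  have hGs : ContDiffOn ℝ 2 (G f) (II aE bE) := by
    have hf2 : ContDiffOn ℝ 2 f (II aE bE) := hf.of_le (by
      have : ((2 : ℕ∞) : WithTop ℕ∞) ≤ ((⊤ : ℕ∞) : WithTop ℕ∞) := WithTop.coe_le_coe.2 le_top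
      exact this)
    exact (hf2.pow 2).inv (fun x hx => pow_ne_zero _ (hfpos x hx).ne')
  have hnb : II aE bE ∈ 𝓝 τ0 := hopen.mem_nhds hτ0
  have hGd : ∀ t ∈ II aE bE, DifferentiableAt ℝ (G f) t := fun t ht =>
    (hGs.differentiableOn (by norm_num)).differentiableAt (hopen.mem_nhds ht)
  have hG2 : DifferentiableAt ℝ (deriv (G f)) τ0 := by
    have h2 : ContDiffOn ℝ 1 (deriv (G f)) (II aE bE) :=
      hGs.deriv_of_isOpen hopen (by norm_num)
    exact (h2.differentiableOn (by norm_num)).differentiableAt hnb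
  obtain ⟨C, hCpos, hC⟩ := hG2.hasDerivAt.isBigO_sub.exists_pos
  have hC := hC.bound
  have hfc : ContinuousAt f τ0 := hf.continuousOn.continuousAt hnb
  have hfb : ∀ᶠ t in 𝓝 τ0, f t < f τ0 + 1 := hfc.eventually_lt continuousAt_const (by linarith)
  obtain ⟨r, hr, hball⟩ := Metric.eventually_nhds_iff.1 (hC.and (hfb.and hnb))
  set δ := min ε (r / 2) with hδ
  have hδ0 : 0 < δ := by positivity
  have hδε : δ ≤ ε := min_le_left _ _
  have hδr : δ < r := lt_of_le_of_lt (min_le_right _ _) (by linarith)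
  have hb : ∀ t ∈ Icc τ0 (τ0 + δ), ‖deriv (G f) t‖ ≤ C * (t - τ0) ∧ f t < f τ0 + 1 ∧
      t ∈ II aE bE := by
    intro t ht
    have h3 := @hball t (by rw [Real.dist_eq, abs_of_nonneg (by linarith [ht.1])]; linarith [ht.2])
    refine ⟨?_, h3.2.1, h3.2.2⟩
    have h4 := h3.1
    rw [hG', sub_zero, Real.norm_of_nonneg (show 0 ≤ t - τ0 by linarith [ht.1])] at h4
    exact h4
  have hquad : ∀ t ∈ Ioc τ0 (τ0 + δ), G f t - G f τ0 ≤ C * (t - τ0) ^ 2 := by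
    intro t ht
    have h5 := Convex.norm_image_sub_le_of_norm_deriv_le (f := G f) (s := Icc τ0 t)
      (C := C * (t - τ0)) (x := τ0) (y := t)
      (fun x hx => hGd x (hb x ⟨hx.1, hx.2.trans ht.2⟩).2.2)
      (fun x hx => (hb x ⟨hx.1, hx.2.trans ht.2⟩).1.trans (by gcongr; exact hx.2))
      (convex_Icc _ _) ⟨le_rfl, ht.1.le⟩ ⟨ht.1.le, le_rfl⟩
    rw [Real.norm_eq_abs, Real.norm_of_nonneg (show 0 ≤ t - τ0 by linarith [ht.1])] at h5
    calc _ ≤ _ := le_abs_self _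
      _ ≤ _ := h5
      _ = _ := by ring
  set M := (f τ0 + 1) ^ 2 with hM
  have hf0 : 0 < f τ0 := hfpos _ hτ0
  have hMpos : 0 < M := by positivity
  set K := Real.sqrt C with hK
  have hKpos : 0 < K := Real.sqrt_pos.2 hCpos
  have hKsq : K ^ 2 = C := Real.sq_sqrt hCpos.le
  let d : ℕ → ℝ := fun n => Real.sqrt (G f τ0 - Dn n)
  have hdlim : Tendsto d atTop (𝓝 0) := by
    have h6 : Tendsto (fun n => G f τ0 - Dn n) atTop (𝓝 0) := by
      simpa using tendsto_const_nhds (x := G f τ0).sub hlim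
    have h7 := (Real.continuous_sqrt.tendsto 0).comp h6
    rw [Real.sqrt_zero] at h7
    exact h7
  let l : ℕ → ℝ → ℝ≥0∞ := fun n t => ENNReal.ofReal ((M * (K * (t - τ0) + d n))⁻¹)
  have hle : ∀ n, ∫⁻ t in Ioc τ0 (τ0 + δ), l n t ≤ ∫⁻ τ in Ioc τ0 (τ0 + ε), h f (Dn n) τ := by
    intro n
    refine le_trans ?_ (lintegral_mono_set (Ioc_subset_Ioc_right (show τ0 + δ ≤ τ0 + ε by linarith)))
    refine setLIntegral_mono' measurableSet_Ioc (fun t ht => ?_)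
    have hbt := hb t ⟨ht.1.le, ht.2⟩
    have hft := hfpos t hbt.2.2
    have hpos : 0 < G f t - Dn n := sub_pos.2 (hlt n t ⟨ht.1, by linarith [ht.2]⟩)
    have hs := Real.sqrt_pos.2 hpos
    have hDle : Dn n ≤ G f τ0 := hmono.monotone.ge_of_tendsto hlim n
    have hd0 : 0 ≤ d n := Real.sqrt_nonneg _
    have hd2 : d n ^ 2 = G f τ0 - Dn n := Real.sq_sqrt (by linarith)
    have htp : 0 < t - τ0 := by linarith [ht.1]
    refine ENNReal.ofReal_le_ofReal (inv_anti₀ (by positivity) ?_)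
    have h7 : Real.sqrt (G f t - Dn n) ≤ K * (t - τ0) + d n := by
      refine Real.sqrt_le_iff.2 ⟨by positivity, ?_⟩
      have h8 := hquad t ht
      have h9 : 0 ≤ K * (t - τ0) * d n := by positivity
      calc G f t - Dn n ≤ C * (t - τ0) ^ 2 + d n ^ 2 := by rw [hd2]; linarith
        _ ≤ _ := by rw [← hKsq]; nlinarith
    have h10 : f t ^ 2 ≤ M := by rw [hM]; gcongr; exact hbt.2.1.le
    gcongr
  have hlinf : ∀ t ∈ Ioc τ0 (τ0 + δ),
      liminf (fun n => l n t) atTop = ENNReal.ofReal ((M * K)⁻¹ * (t - τ0)⁻¹) := by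
    intro t ht
    have htp : 0 < t - τ0 := by linarith [ht.1]
    refine Tendsto.liminf_eq ?_
    refine ENNReal.tendsto_ofReal ?_
    have h11 : Tendsto (fun n => (M * (K * (t - τ0) + d n))⁻¹) atTop
        (𝓝 ((M * (K * (t - τ0) + 0))⁻¹)) :=
      ((hdlim.const_add _).const_mul _).inv₀ (by positivity)
    convert h11 using 2
    rw [← mul_inv, add_zero, mul_assoc]
  have htop : ∫⁻ t in Ioc τ0 (τ0 + δ), ENNReal.ofReal ((M * K)⁻¹ * (t - τ0)⁻¹) = ⊤ := by
    by_contra hne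
    have hmeas : Measurable (fun t : ℝ => (M * K)⁻¹ * (t - τ0)⁻¹) := by fun_prop
    have hint : IntegrableOn (fun t : ℝ => (M * K)⁻¹ * (t - τ0)⁻¹) (Ioc τ0 (τ0 + δ)) := by
      refine (lintegral_ofReal_ne_top_iff_integrable hmeas.aestronglyMeasurable ?_).1 hne
      filter_upwards [ae_restrict_mem measurableSet_Ioc] with t ht
      have htp : 0 < t - τ0 := by linarith [ht.1]
      simp only [Pi.zero_apply]
      positivity
    have hint2 : IntegrableOn (fun t : ℝ => (t - τ0)⁻¹) (Ioc τ0 (τ0 + δ)) := by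
      have h12 := hint.const_mul (M * K)
      have hne' : M * K ≠ 0 := by positivity
      simp only [mul_inv_cancel_left₀ hne'] at h12
      exact h12
    have h13 := (intervalIntegrable_iff_integrableOn_Ioc_of_le (by linarith)).2 hint2
    rw [intervalIntegrable_sub_inv_iff] at h13
    rcases h13 with h13 | h13
    · linarith
    · exact h13 left_mem_uIcc
  refine tendsto_of_le_liminf_of_limsup_le ?_ le_top
  calc (⊤ : ℝ≥0∞) = ∫⁻ t in Ioc τ0 (τ0 + δ), liminf (fun n => l n t) atTop := by
        rw [← htop]
        exact (setLIntegral_congr_fun measurableSet_Ioc hlinf).symm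
    _ ≤ liminf (fun n => ∫⁻ t in Ioc τ0 (τ0 + δ), l n t) atTop :=
        lintegral_liminf_le (fun n => by fun_prop)
    _ ≤ _ := liminf_le_liminf (Eventually.of_forall hle)
end
end

section
/- If Condition (B) does not hold at b, then lim_{τ→b} f(τ) exists in (0, ∞] and there is c' ∈ (a,b) with f' > 0 on (c', b). Symmetrically, if Condition (B) does not hold at a, then lim_{τ→a} f(τ) exists in (0, ∞] and there is c' ∈ (a,b) with f' < 0 on (a, c'). -/
open Set Filter MeasureTheory Topology
open scoped ENNReal NNReal

noncomputable section

open Set Filter MeasureTheory Topology GRW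
open scoped ENNReal

namespace GRW

lemma II_isOpen (aE bE : EReal) : IsOpen (II aE bE) :=
  (isOpen_lt continuous_const continuous_coe_real_ereal).inter
    (isOpen_lt continuous_coe_real_ereal continuous_const)

lemma lint_top (c s k : ℝ) (hcs : c < s) (hk : 0 < k) (g : ℝ → ℝ)
    (hg : ∀ τ ∈ Ioo c s, k * (s - τ)⁻¹ ≤ g τ) :
    ∫⁻ τ in Ioo c s, ENNReal.ofReal (g τ) = ⊤ := by
  by_contra hne
  have hlt : ∫⁻ τ in Ioo c s, ENNReal.ofReal (k * (s - τ)⁻¹) < ⊤ := by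
    refine lt_of_le_of_lt ?_ (lt_top_iff_ne_top.2 hne)
    exact setLIntegral_mono' measurableSet_Ioo fun τ hτ => ENNReal.ofReal_le_ofReal (hg τ hτ)
  have hint : IntegrableOn (fun τ => k * (s - τ)⁻¹) (Ioo c s) := by
    refine ⟨by fun_prop, ?_⟩
    rw [hasFiniteIntegral_iff_ofReal]
    · exact hlt
    · filter_upwards [ae_restrict_mem measurableSet_Ioo] with τ hτ
      have : 0 < s - τ := by linarith [hτ.2]
      show 0 ≤ k * (s - τ)⁻¹
      positivity
  have h2 : IntegrableOn (fun τ => (τ - s)⁻¹) (Ioo c s) := by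
    have := hint.const_mul (-k⁻¹)
    refine this.congr (Eventually.of_forall fun τ => ?_)
    show -k⁻¹ * (k * (s - τ)⁻¹) = (τ - s)⁻¹
    rw [← neg_sub τ s, inv_neg]
    field_simp
  have h3 : IntervalIntegrable (fun τ => (τ - s)⁻¹) volume c s := by
    rw [intervalIntegrable_iff_integrableOn_Ioo_of_le hcs.le]
    exact h2
  rw [intervalIntegrable_sub_inv_iff] at h3
  rcases h3 with h3 | h3
  · exact hcs.ne h3
  · exact h3 right_mem_uIcc

lemma quad_bound (g : ℝ → ℝ) (s : ℝ) (hg : ContDiffAt ℝ 2 g s) (hd : 0 ≤ deriv g s) :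
    ∃ K > 0, ∃ e < s, ∀ τ ∈ Ioo e s, g τ - g s ≤ K * (s - τ) ^ 2 := by
  have h1 : ContDiffAt ℝ 1 (deriv g) s := by
    exact hg.derivWithin (m := 1) (by norm_num)
  have h2 := (h1.differentiableAt (by norm_num)).hasDerivAt.isBigO_sub
  obtain ⟨K, hK, hb⟩ := h2.exists_pos
  have hb := hb.bound
  have h3 : ∀ᶠ t in 𝓝 s, DifferentiableAt ℝ g t := by
    filter_upwards [hg.eventually (by simp)] with t ht
    exact ht.differentiableAt (by norm_num)
  obtain ⟨δ, hδ, hball⟩ := Metric.eventually_nhds_iff_ball.1 (hb.and h3)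
  refine ⟨K, hK, s - δ, by linarith, fun τ hτ => ?_⟩
  have hin : ∀ t ∈ Icc τ s, t ∈ Metric.ball s δ := by
    intro t ht
    rw [Metric.mem_ball, Real.dist_eq, abs_lt]
    constructor <;> linarith [hτ.1, ht.1, ht.2]
  have := (convex_Icc τ s).norm_image_sub_le_of_norm_hasDerivWithin_le
    (f := fun t => g t - deriv g s * t) (f' := fun t => deriv g t - deriv g s)
    (C := K * (s - τ)) (x := s) (y := τ) ?_ ?_ ?_ ?_
  · rw [Real.norm_eq_abs, Real.norm_eq_abs, abs_of_neg (show τ - s < 0 by linarith [hτ.2])] at this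
    have h5 := (abs_le.1 this).2
    nlinarith [mul_nonneg hd (sub_nonneg.2 hτ.2.le)]
  · intro t ht
    have h6 := ((hball t (hin t ht)).2.hasDerivAt.sub ((hasDerivAt_id t).const_mul (deriv g s)))
    simp only [mul_one] at h6
    exact h6.hasDerivWithinAt
  · intro t ht
    refine (hball t (hin t ht)).1.trans ?_
    rw [Real.norm_eq_abs, abs_of_nonpos (by linarith [ht.2])]
    exact mul_le_mul_of_nonneg_left (by linarith [ht.1]) hK.le
  · exact right_mem_Icc.2 hτ.2.le
  · exact left_mem_Icc.2 hτ.2.le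

lemma G_contDiffAt (aE bE : EReal) (f : ℝ → ℝ)
    (hf : ContDiffOn ℝ (⊤ : ℕ∞) f (II aE bE)) (hfpos : ∀ τ ∈ II aE bE, 0 < f τ)
    (τ : ℝ) (hτ : τ ∈ II aE bE) : ContDiffAt ℝ 2 (G f) τ := by
  have h1 : ContDiffAt ℝ 2 f τ :=
    (hf.contDiffAt ((II_isOpen aE bE).mem_nhds hτ)).of_le (by
      norm_cast)
  have := hfpos τ hτ
  exact (h1.pow 2).inv (by positivity)

lemma G_deriv (aE bE : EReal) (f : ℝ → ℝ)
    (hf : ContDiffOn ℝ (⊤ : ℕ∞) f (II aE bE)) (hfpos : ∀ τ ∈ II aE bE, 0 < f τ)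
    (τ : ℝ) (hτ : τ ∈ II aE bE) (hd : deriv f τ ≤ 0) : 0 ≤ deriv (G f) τ := by
  have h1 : DifferentiableAt ℝ f τ :=
    (hf.contDiffAt ((II_isOpen aE bE).mem_nhds hτ)).differentiableAt (by simp)
  have hp := hfpos τ hτ
  have h2 := ((h1.hasDerivAt.pow 2).inv (by simp; positivity)).deriv
  have h3 : deriv (G f) τ = _ := h2
  rw [h3]
  apply div_nonneg _ (by positivity)
  have : f τ * deriv f τ ≤ 0 := mul_nonpos_of_nonneg_of_nonpos hp.le hd
  simp
  nlinarith

lemma first_min (g : ℝ → ℝ) (c τ1 t0 : ℝ) (hg : ContinuousOn g (Icc c τ1))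
    (h0 : c < t0) (h1 : t0 ≤ τ1) (hlt : g t0 < g c) (hd : 0 ≤ deriv g τ1) :
    ∃ s, c < s ∧ s ≤ τ1 ∧ g s ≤ g t0 ∧ 0 ≤ deriv g s ∧ ∀ t, c ≤ t → t < s → g s < g t := by
  obtain ⟨s0, hs0, hmin⟩ := isCompact_Icc.exists_isMinOn ⟨t0, h0.le, h1⟩ hg
  have hcomp : IsCompact (Icc c τ1 ∩ g ⁻¹' {g s0}) :=
    isCompact_Icc.of_isClosed_subset
      (hg.preimage_isClosed_of_isClosed isClosed_Icc isClosed_singleton) inter_subset_left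
  obtain ⟨s, hs, hleast⟩ := hcomp.exists_isLeast ⟨s0, hs0, rfl⟩
  have hgs : g s = g s0 := hs.2
  have hge : ∀ t ∈ Icc c τ1, g s ≤ g t := fun t ht => hgs ▸ hmin ht
  have hst0 := hge t0 ⟨h0.le, h1⟩
  have hcs : c < s := by
    rcases hs.1.1.lt_or_eq with h | h
    · exact h
    · subst h; linarith
  refine ⟨s, hcs, hs.1.2, hst0, ?_, fun t hct hts => ?_⟩
  · rcases hs.1.2.lt_or_eq with h | h
    · have : IsLocalMin g s := by
        filter_upwards [Icc_mem_nhds hcs h] with t ht using hge t ht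
      rw [this.deriv_eq_zero]
    · rw [h]; exact hd
  · have hm : t ∈ Icc c τ1 := ⟨hct, hts.le.trans hs.1.2⟩
    refine lt_of_le_of_ne (hge t hm) fun heq => ?_
    exact absurd (hleast ⟨hm, (heq.symm.trans hgs)⟩) (not_le.2 hts)

lemma Fb_mem (bE : EReal) (c : ℝ) (hc : (c : EReal) < bE) :
    ∀ᶠ τ in Fb bE, c < τ ∧ (τ : EReal) < bE := by
  have := (Ioo_mem_nhdsLT hc)
  filter_upwards [preimage_mem_comap this] with τ hτ
  exact ⟨EReal.coe_lt_coe_iff.1 hτ.1, hτ.2⟩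

lemma main_b (aE bE : EReal) (f : ℝ → ℝ)
    (hf : ContDiffOn ℝ (⊤ : ℕ∞) f (II aE bE)) (hfpos : ∀ τ ∈ II aE bE, 0 < f τ)
    (J : Set ℝ) (hB : ¬ CondB_b aE bE f J) :
      ∃ c' ∈ II aE bE, ∀ τ ∈ II aE bE, c' < τ → 0 < deriv f τ := by
  unfold CondB_b CondA_b at hB
  push Not at hB
  obtain ⟨⟨⟨c0, hc0⟩, hA⟩, hB⟩ := hB
  by_contra hcon
  push Not at hcon
  -- move c to the right
  obtain ⟨c, hc1, hc2⟩ : ∃ c : ℝ, c0 < c ∧ (c : EReal) < bE := by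
    obtain ⟨x, hx1, hx2⟩ := EReal.lt_iff_exists_real_btwn.1 hc0.1.2
    exact ⟨x, by exact_mod_cast hx1, hx2⟩
  have hac : aE < (c : EReal) := hc0.1.1.trans (by exact_mod_cast hc1)
  have hrel : RelMinB aE bE f c :=
    ⟨⟨hac, hc2⟩, fun τ h1 h2 => hc0.2 τ (hc1.trans h1) h2⟩
  have hmc := hc0.2 c hc1 hc2
  have hm0 : (0 : EReal) ≤ mB bE f := by
    refine le_liminf_of_le (by isBoundedDefault) (Eventually.of_forall fun τ => ?_)
    have : 0 ≤ G f τ := by unfold G; positivity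
    exact_mod_cast this
  obtain ⟨m, hm⟩ : ∃ m : ℝ, mB bE f = m :=
    ⟨_, (EReal.coe_toReal (ne_top_of_lt hmc) (ne_bot_of_le_ne_bot (by simp) hm0)).symm⟩
  have hfin := hA c hrel
  have hdiam := hB c hrel
  have hlim : limsup (fun D => IbStar bE f c D) (𝓝[>] (mB bE f).toReal) = ⊤ := by
    rw [hm, EReal.toReal_coe, eq_top_iff]
    refine le_limsup_of_frequently_le ?_ (by isBoundedDefault)
    rw [(nhdsGT_basis m).frequently_iff]
    intro u hu
    have hlt : mB bE f < ((min u (G f c) : ℝ) : EReal) := by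
      rw [hm] at hmc ⊢
      exact_mod_cast lt_min hu (by exact_mod_cast hmc)
    have hfreq : ∃ᶠ τ in Fb bE, (G f τ : EReal) < ((min u (G f c) : ℝ) : EReal) :=
      frequently_lt_of_liminf_lt (by isBoundedDefault) hlt
    obtain ⟨t0, ht0, hct0, ht0b⟩ := (hfreq.and_eventually (Fb_mem bE c hc2)).exists
    have ht0' : G f t0 < min u (G f c) := by exact_mod_cast ht0
    obtain ⟨τ1, hτ1, h01, hd⟩ := hcon t0 ⟨hac.trans (by exact_mod_cast hct0), ht0b⟩
    have hdG := G_deriv aE bE f hf hfpos τ1 hτ1 hd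
    have hII : ∀ t, c ≤ t → t ≤ τ1 → t ∈ II aE bE := fun t h1 h2 =>
      ⟨hac.trans_le (by exact_mod_cast h1), lt_of_le_of_lt (by exact_mod_cast h2) hτ1.2⟩
    have hcont : ContinuousOn (G f) (Icc c τ1) := fun t ht =>
      (G_contDiffAt aE bE f hf hfpos t (hII t ht.1 ht.2)).continuousAt.continuousWithinAt
    obtain ⟨s, hcs, hs1, hsle, hds, hsl⟩ := first_min (G f) c τ1 t0 hcont hct0 h01.le
      (ht0'.trans_le (min_le_right _ _)) hdG
    have hsI := hII s hcs.le hs1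
    refine ⟨G f s, ⟨?_, ?_⟩, ?_⟩
    · have := hrel.2 s hcs hsI.2
      rw [hm] at this
      exact_mod_cast this
    · exact hsle.trans_lt (ht0'.trans_le (min_le_left _ _))
    obtain ⟨K, hK, e, hes, hquad⟩ := quad_bound (G f) s
      (G_contDiffAt aE bE f hf hfpos s hsI) hds
    have hfc : ContinuousOn f (Icc c s) := hf.continuousOn.mono fun t ht =>
      hII t ht.1 (ht.2.trans hs1)
    obtain ⟨M, hM⟩ := isCompact_Icc.bddAbove_image hfc
    have hMf : ∀ t ∈ Icc c s, f t ≤ M := fun t ht => hM (mem_image_of_mem f ht)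
    have hM0 : 0 < M := (hfpos s hsI).trans_le (hMf s ⟨hcs.le, le_rfl⟩)
    have hmax : max c e < s := max_lt hcs hes
    have htop := lint_top (max c e) s (M ^ 2 * Real.sqrt K)⁻¹ hmax (by positivity)
      (fun τ => (f τ ^ 2 * Real.sqrt (G f τ - G f s))⁻¹) (by
        intro τ hτ
        have hcτ : c < τ := (le_max_left _ _).trans_lt hτ.1
        have heτ : e < τ := (le_max_right _ _).trans_lt hτ.1
        have hsτ : 0 < s - τ := by linarith [hτ.2]
        have hpos : 0 < G f τ - G f s := by linarith [hsl τ hcτ.le hτ.2]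
        have hq := hquad τ ⟨heτ, hτ.2⟩
        have hfτ := hfpos τ (hII τ hcτ.le (hτ.2.le.trans hs1))
        have hfM := hMf τ ⟨hcτ.le, hτ.2.le⟩
        show _ ≤ (f τ ^ 2 * Real.sqrt (G f τ - G f s))⁻¹
        rw [← mul_inv]
        have hsq := Real.sqrt_pos.2 hpos
        apply inv_anti₀ (by positivity)
        rw [mul_assoc]
        have hs2 : Real.sqrt (G f τ - G f s) ≤ Real.sqrt K * (s - τ) := by
          refine (Real.sqrt_le_sqrt hq).trans ?_
          rw [Real.sqrt_mul hK.le, Real.sqrt_sq hsτ.le]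
        gcongr)
    rw [← htop]
    unfold IbStar h
    apply lintegral_mono_set
    intro τ hτ
    refine ⟨(le_max_left _ _).trans_lt hτ.1, ?_⟩
    have hle : (s : EReal) ≤ bstar bE f c (G f s) := by
      unfold bstar
      apply le_sInf
      rintro x (rfl | ⟨t, ⟨ht1, ht2, ht3⟩, rfl⟩)
      · exact hsI.2.le
      · by_contra hlt
        have hlt' : t < s := by simpa using hlt
        exact absurd ht3 (hsl t ht1.le hlt').ne'
    exact lt_of_lt_of_le (by exact_mod_cast hτ.2) hle
  have : dB bE f c = ⊤ := by
    unfold dB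
    rw [hlim, ENNReal.top_sub hfin]
  rw [this, ENNReal.mul_top (by norm_num)] at hdiam
  exact not_top_lt hdiam

lemma lim_b (aE bE : EReal) (f : ℝ → ℝ)
    (hf : ContDiffOn ℝ (⊤ : ℕ∞) f (II aE bE)) (hfpos : ∀ τ ∈ II aE bE, 0 < f τ)
    (hc : ∃ c' ∈ II aE bE, ∀ τ ∈ II aE bE, c' < τ → 0 < deriv f τ) :
    ∃ l : EReal, 0 < l ∧ Tendsto (fun τ => (f τ : EReal)) (Fb bE) (𝓝 l) := by
  obtain ⟨c, hcI, hd⟩ := hc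
  set S : Set ℝ := {τ | c ≤ τ ∧ (τ : EReal) < bE} with hS
  have hSI : S ⊆ II aE bE := fun t ht => ⟨hcI.1.trans_le (by exact_mod_cast ht.1), ht.2⟩
  have hmono : MonotoneOn f S := by
    have hconv : Convex ℝ S := by
      apply OrdConnected.convex
      constructor
      intro x hx y hy z hz
      exact ⟨hx.1.trans hz.1, lt_of_le_of_lt (by exact_mod_cast hz.2) hy.2⟩
    refine (strictMonoOn_of_deriv_pos hconv (hf.continuousOn.mono hSI) ?_).monotoneOn
    intro x hx
    refine hd x (hSI (interior_subset hx)) ?_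
    have : x ∈ interior (Ici c) := interior_mono (fun t ht => ht.1) hx
    simpa using this
  have hcS : c ∈ S := ⟨le_rfl, hcI.2⟩
  set L : EReal := sSup ((fun τ : ℝ => (f τ : EReal)) '' S) with hL
  have hle : ∀ t ∈ S, (f t : EReal) ≤ L := fun t ht => le_sSup ⟨t, ht, rfl⟩
  refine ⟨L, lt_of_lt_of_le (by exact_mod_cast hfpos c hcI) (hle c hcS), ?_⟩
  rw [tendsto_order]
  constructor
  · intro x hx
    obtain ⟨_, ⟨t, ht, rfl⟩, hxt⟩ := lt_sSup_iff.1 hx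
    filter_upwards [Fb_mem bE t ht.2] with τ hτ
    refine lt_of_lt_of_le hxt ?_
    exact EReal.coe_le_coe_iff.2 <| hmono ht ⟨ht.1.trans hτ.1.le, hτ.2⟩ hτ.1.le
  · intro x hx
    filter_upwards [Fb_mem bE c hcI.2] with τ hτ
    exact (hle τ ⟨hτ.1.le, hτ.2⟩).trans_lt hx

/-! Reflection -/

lemma neg_lt_coe (x : EReal) (τ : ℝ) : -x < ((-τ : ℝ) : EReal) ↔ (τ : EReal) < x := by
  rw [EReal.coe_neg, EReal.neg_lt_neg_iff]

lemma coe_lt_neg (x : EReal) (τ : ℝ) : ((-τ : ℝ) : EReal) < -x ↔ x < (τ : EReal) := by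
  rw [EReal.coe_neg, EReal.neg_lt_neg_iff]

lemma Fa_eq (aE : EReal) : Fb (-aE) = map Neg.neg (Fa aE) := by
  have e1 : (𝓝[<] (-aE)) = comap Neg.neg (𝓝[>] aE) := by
    have := (Homeomorph.neg EReal).isEmbedding.map_nhdsWithin_eq (Ioi aE) aE
    have h2 : map (Neg.neg : EReal → EReal) (𝓝[>] aE) = 𝓝[<] (-aE) := by
      have h3 : ((Homeomorph.neg EReal) '' Ioi aE) = Iio (-aE) := by
        ext x
        constructor
        · rintro ⟨y, hy, rfl⟩
          exact EReal.neg_lt_neg_iff.2 hy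
        · intro hx
          exact ⟨-x, EReal.lt_neg_comm.1 hx, neg_neg x⟩
      rw [h3] at this
      exact this
    rw [← h2]
    exact map_eq_comap_of_inverse (funext fun x => neg_neg x) (funext fun x => neg_neg x)
  have e2 : map (Neg.neg : ℝ → ℝ) (Fa aE) = comap Neg.neg (Fa aE) :=
    map_eq_comap_of_inverse (funext fun x => neg_neg x) (funext fun x => neg_neg x)
  rw [e2, Fb, e1, Fa, comap_comap, comap_comap]
  congr 1

lemma mA_eq (aE : EReal) (f : ℝ → ℝ) : mB (-aE) (fun t => f (-t)) = mA aE f := by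
  unfold mB mA
  rw [Fa_eq, ← liminf_comp]
  congr 1
  funext t
  simp [G]

lemma lint_neg (S : Set ℝ) (g : ℝ → ℝ≥0∞) :
    ∫⁻ τ in S, g τ = ∫⁻ τ in (Neg.neg ⁻¹' S), g (-τ) := by
  have hp : MeasurePreserving (Neg.neg : ℝ → ℝ) volume volume := Measure.measurePreserving_neg _
  exact (hp.setLIntegral_comp_preimage_emb (Homeomorph.neg ℝ).measurableEmbedding g S).symm

lemma IaInt_eq (aE : EReal) (f : ℝ → ℝ) (c D : ℝ) :
    IbInt (-aE) (fun t => f (-t)) (-c) D = IaInt aE f c D := by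
  unfold IbInt IaInt
  rw [lint_neg]
  congr 1
  · congr 1
    ext τ
    simp only [mem_preimage, mem_setOf_eq, coe_lt_neg, neg_lt_neg_iff]
    tauto
  · funext τ
    simp [h, G]

lemma bstar_eq (aE : EReal) (f : ℝ → ℝ) (c D : ℝ) :
    bstar (-aE) (fun t => f (-t)) (-c) D = -astar aE f c D := by
  unfold bstar astar
  apply le_antisymm
  · rw [EReal.le_neg]
    apply sSup_le
    rintro x (rfl | ⟨t, ⟨h1, h2, h3⟩, rfl⟩)
    · rw [EReal.le_neg]
      exact sInf_le (Or.inl rfl)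
    · rw [EReal.le_neg]
      refine sInf_le (Or.inr ⟨-t, ⟨by linarith, (coe_lt_neg _ _).2 h2, ?_⟩, EReal.coe_neg t⟩)
      simpa [G] using h3
  · apply le_sInf
    rintro x (rfl | ⟨t, ⟨h1, h2, h3⟩, rfl⟩)
    · exact EReal.neg_le_neg_iff.2 (le_sSup (Or.inl rfl))
    · show _ ≤ (t : EReal)
      rw [EReal.neg_le, ← EReal.coe_neg]
      refine le_sSup (Or.inr ⟨-t, ⟨by linarith, ?_, by simpa [G] using h3⟩, rfl⟩)
      rw [← coe_lt_neg, neg_neg]; exact h2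

lemma IaStar_eq (aE : EReal) (f : ℝ → ℝ) (c D : ℝ) :
    IbStar (-aE) (fun t => f (-t)) (-c) D = IaStar aE f c D := by
  unfold IbStar IaStar
  rw [lint_neg, bstar_eq]
  congr 1
  · congr 1
    ext τ
    simp only [mem_preimage, mem_setOf_eq, coe_lt_neg, neg_lt_neg_iff]
    tauto
  · funext τ
    simp [h, G]

lemma dA_eq (aE : EReal) (f : ℝ → ℝ) (c : ℝ) :
    dB (-aE) (fun t => f (-t)) (-c) = dA aE f c := by
  unfold dB dA
  simp only [IaStar_eq, IaInt_eq, mA_eq]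

lemma II_neg (aE bE : EReal) (τ : ℝ) : -τ ∈ II (-bE) (-aE) ↔ τ ∈ II aE bE := by
  simp only [II, mem_setOf_eq, coe_lt_neg, neg_lt_coe]
  tauto

lemma RelMinA_eq (aE bE : EReal) (f : ℝ → ℝ) (c : ℝ) :
    RelMinB (-bE) (-aE) (fun t => f (-t)) (-c) ↔ RelMinA aE bE f c := by
  unfold RelMinB RelMinA
  rw [II_neg, mA_eq]
  refine and_congr_right fun _ => ⟨fun H τ h1 h2 => ?_, fun H τ h1 h2 => ?_⟩
  · simpa [G] using H (-τ) (by linarith) ((coe_lt_neg _ _).2 h2)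
  · have := H (-τ) (by linarith) (by rw [← coe_lt_neg, neg_neg]; exact h2)
    simpa [G] using this

lemma RelMinA_ex (aE bE : EReal) (f : ℝ → ℝ) (P Q : ℝ → Prop) (hPQ : ∀ c, P (-c) ↔ Q c) :
    (∃ c, RelMinB (-bE) (-aE) (fun t => f (-t)) c ∧ P c) ↔ ∃ c, RelMinA aE bE f c ∧ Q c := by
  constructor
  · rintro ⟨c, h1, h2⟩
    refine ⟨-c, (RelMinA_eq _ _ _ _).1 (by rwa [neg_neg]), (hPQ _).1 (by rwa [neg_neg])⟩
  · rintro ⟨c, h1, h2⟩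
    exact ⟨-c, (RelMinA_eq _ _ _ _).2 h1, (hPQ _).2 h2⟩

lemma CondB_eq (aE bE : EReal) (f : ℝ → ℝ) (J : Set ℝ) :
    CondB_b (-bE) (-aE) (fun t => f (-t)) J ↔ CondB_a aE bE f J := by
  have h0 := RelMinA_ex aE bE f (fun _ => True) (fun _ => True) (fun _ => Iff.rfl)
  simp only [and_true] at h0
  unfold CondB_b CondB_a CondA_b CondA_a
  rw [h0, RelMinA_ex aE bE f _ (fun c => IaInt aE f c (mA aE f).toReal = ⊤)
      (fun c => by rw [mA_eq, IaInt_eq]),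
    RelMinA_ex aE bE f _ (fun c => EMetric.diam J ≤ 2 * dA aE f c) (fun c => by rw [dA_eq])]

end GRW

/-- **Lemma 3.** If Condition (B) fails at `b`, then `f` has a limit in
`(0,∞]` at `b` and `f' > 0` on some subinterval `(c',b)`; symmetrically at `a`. -/
theorem limit_and_monotone_of_not_condB
    (aE bE : EReal) (hab : aE < bE) (f : ℝ → ℝ)
    (hf : ContDiffOn ℝ (⊤ : ℕ∞) f (II aE bE)) (hfpos : ∀ τ ∈ II aE bE, 0 < f τ)
    (J : Set ℝ) (hJ : ∃ c d : EReal, c < d ∧ J = {x : ℝ | c < (x : EReal) ∧ (x : EReal) < d}) :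
    (¬ CondB_b aE bE f J →
      (∃ l : EReal, 0 < l ∧ Tendsto (fun τ => (f τ : EReal)) (Fb bE) (𝓝 l)) ∧
      ∃ c' ∈ II aE bE, ∀ τ ∈ II aE bE, c' < τ → 0 < deriv f τ) ∧
    (¬ CondB_a aE bE f J →
      (∃ l : EReal, 0 < l ∧ Tendsto (fun τ => (f τ : EReal)) (Fa aE) (𝓝 l)) ∧
      ∃ c' ∈ II aE bE, ∀ τ ∈ II aE bE, τ < c' → deriv f τ < 0) := by
  refine ⟨fun hB => ?_, fun hB => ?_⟩
  · have h1 := main_b aE bE f hf hfpos J hB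
    exact ⟨lim_b aE bE f hf hfpos h1, h1⟩
  · have hII : ∀ τ, τ ∈ II (-bE) (-aE) → -τ ∈ II aE bE := fun τ hτ => by
      rw [← II_neg, neg_neg]; exact hτ
    have hf' : ContDiffOn ℝ (⊤ : ℕ∞) (fun t => f (-t)) (II (-bE) (-aE)) :=
      hf.comp contDiff_neg.contDiffOn hII
    have hp' : ∀ τ ∈ II (-bE) (-aE), 0 < (fun t => f (-t)) τ := fun τ hτ => hfpos _ (hII τ hτ)
    have h1 := main_b (-bE) (-aE) (fun t => f (-t)) hf' hp' J (by rwa [CondB_eq])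
    obtain ⟨l, hl, ht⟩ := lim_b (-bE) (-aE) (fun t => f (-t)) hf' hp' h1
    refine ⟨⟨l, hl, ?_⟩, ?_⟩
    · rw [Fa_eq, tendsto_map'_iff] at ht
      simpa [Function.comp_def] using ht
    · obtain ⟨c, hc, hd⟩ := h1
      refine ⟨-c, hII c hc, fun τ hτ hlt => ?_⟩
      have := hd (-τ) ((II_neg _ _ _).2 hτ) (by linarith)
      rw [deriv_comp_neg, neg_neg] at this
      linarith
end
end

section
/- Suppose b < ∞, lim_{τ→b} f(τ) = α ∈ (0, ∞), lim_{τ→b} f'(τ) = 0, f'' is bounded on [b − ε0, b) for some ε0 > 0, and G(τ) > 1/α² for all τ in some interval (c, b). Then ∫_c^b f(τ)^{−2} (G(τ) − 1/α²)^{−1/2} dτ = ∞. -/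
open Set Filter MeasureTheory Topology
open scoped ENNReal NNReal

noncomputable section

open Set Filter MeasureTheory Topology GRW
open scoped ENNReal

theorem flat_key (g : ℝ → ℝ) (b l t K : ℝ) (ht : t < b)
    (hd : ∀ x ∈ Ico t b, DifferentiableAt ℝ g x)
    (hb : ∀ x ∈ Ico t b, |deriv g x| ≤ K) (hl : Tendsto g (𝓝[<] b) (𝓝 l)) :
    |l - g t| ≤ K * (b - t) := by
  have hK : 0 ≤ K := (abs_nonneg _).trans (hb t ⟨le_refl _, ht⟩)
  have h1 : Tendsto (fun s => |g s - g t|) (𝓝[<] b) (𝓝 |l - g t|) :=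
    (hl.sub_const _).abs
  refine le_of_tendsto h1 ?_
  filter_upwards [Ioo_mem_nhdsLT ht] with s hs
  have h2 := (convex_Ico t b).norm_image_sub_le_of_norm_deriv_le hd hb
    (⟨le_refl _, ht⟩ : t ∈ Ico t b) (⟨hs.1.le, hs.2⟩ : s ∈ Ico t b)
  rw [Real.norm_eq_abs, Real.norm_eq_abs, abs_of_pos (sub_pos.2 hs.1)] at h2
  exact h2.trans (mul_le_mul_of_nonneg_left (by linarith [hs.2]) hK)

theorem flat_div (c b : ℝ) (hcb : c < b) :
    ∫⁻ τ in Ioo c b, ENNReal.ofReal ((b - τ)⁻¹) = ⊤ := by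
  by_contra hne
  have hm : Measurable (fun τ : ℝ => (b - τ)⁻¹) := by fun_prop
  have hI : IntegrableOn (fun τ : ℝ => (b - τ)⁻¹) (Ioo c b) volume := by
    refine ⟨hm.aestronglyMeasurable, ?_⟩
    rw [hasFiniteIntegral_iff_ofReal]
    · exact lt_top_iff_ne_top.2 hne
    · filter_upwards [ae_restrict_mem measurableSet_Ioo] with τ hτ
      exact inv_nonneg.2 (by linarith [hτ.2])
  have h2 : IntervalIntegrable (fun τ : ℝ => (τ - b)⁻¹) volume c b := by
    rw [intervalIntegrable_iff_integrableOn_Ioo_of_le hcb.le]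
    refine hI.neg.congr (Eventually.of_forall fun τ => ?_)
    simp only [Pi.neg_apply]
    rw [← inv_neg, neg_sub]
  rw [intervalIntegrable_sub_inv_iff] at h2
  rcases h2 with h2 | h2
  · exact hcb.ne h2
  · exact h2 right_mem_uIcc

/-- Suppose `b < ∞`, `f → α ∈ (0,∞)` and `f' → 0` at `b`, `f''` is
bounded on `[b−ε0, b)`, and `G > 1/α²` on `(c,b)`. Then
`∫_c^b f⁻²(G − 1/α²)^{-1/2} = ∞`. -/
theorem integral_infinite_of_flat_limit
    (aE : EReal) (bR : ℝ) (hab : aE < (bR : EReal)) (f : ℝ → ℝ)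
    (hf : ContDiffOn ℝ (⊤ : ℕ∞) f (II aE (bR : EReal)))
    (hfpos : ∀ τ ∈ II aE (bR : EReal), 0 < f τ)
    (α : ℝ) (hα : 0 < α)
    (hlim : Tendsto f (𝓝[<] bR) (𝓝 α))
    (hlim' : Tendsto (deriv f) (𝓝[<] bR) (𝓝 0))
    (ε0 : ℝ) (hε0 : 0 < ε0) (hε0a : aE < ((bR - ε0 : ℝ) : EReal))
    (C : ℝ) (hbound : ∀ τ ∈ Ico (bR - ε0) bR, |deriv (deriv f) τ| ≤ C)
    (c : ℝ) (hc : c ∈ II aE (bR : EReal))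
    (hG : ∀ τ, c < τ → τ < bR → (α ^ 2)⁻¹ < G f τ) :
    ∫⁻ τ in Ioo c bR, h f ((α ^ 2)⁻¹) τ = ⊤ := by
  have hopen : IsOpen (II aE (bR : EReal)) := by
    have : II aE (bR : EReal) = (fun τ : ℝ => (τ : EReal)) ⁻¹' Ioo aE (bR : EReal) := rfl
    rw [this]
    exact isOpen_Ioo.preimage continuous_coe_real_ereal
  have hcb : c < bR := EReal.coe_lt_coe_iff.1 hc.2
  set e := max c (bR - ε0) with he
  have heb : e < bR := max_lt hcb (by linarith)
  have hmem : ∀ x ∈ Ico e bR, x ∈ II aE (bR : EReal) := fun x hx =>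
    ⟨hc.1.trans_le (EReal.coe_le_coe_iff.2 ((le_max_left _ _).trans hx.1)),
      EReal.coe_lt_coe_iff.2 hx.2⟩
  have hd1 : ∀ x ∈ Ico e bR, DifferentiableAt ℝ f x := fun x hx =>
    (hf.differentiableOn (by simp)).differentiableAt (hopen.mem_nhds (hmem x hx))
  have hf' : ContDiffOn ℝ 1 (deriv f) (II aE (bR : EReal)) :=
    hf.deriv_of_isOpen hopen (by norm_cast)
  have hd2 : ∀ x ∈ Ico e bR, DifferentiableAt ℝ (deriv f) x := fun x hx =>
    (hf'.differentiableOn (by simp)).differentiableAt (hopen.mem_nhds (hmem x hx))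
  set M := |C| + 1 with hM
  have hMpos : 0 < M := by positivity
  have b1 : ∀ x ∈ Ico e bR, |deriv f x| ≤ M * (bR - x) := by
    intro x hx
    have := flat_key (deriv f) bR 0 x M hx.2 (fun y hy => hd2 y ⟨hx.1.trans hy.1, hy.2⟩)
      (fun y hy => (hbound y ⟨(le_max_right c _).trans (hx.1.trans hy.1), hy.2⟩).trans
        (by linarith [le_abs_self C])) hlim'
    simpa using this
  have b2 : ∀ x ∈ Ico e bR, |α - f x| ≤ M * (bR - x) ^ 2 := by
    intro x hx
    have := flat_key f bR α x (M * (bR - x)) hx.2 (fun y hy => hd1 y ⟨hx.1.trans hy.1, hy.2⟩)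
      (fun y hy => (b1 y ⟨hx.1.trans hy.1, hy.2⟩).trans
        (mul_le_mul_of_nonneg_left (by linarith [hy.1]) hMpos.le)) hlim
    calc _ ≤ _ := this
      _ = _ := by ring
  set K := Real.sqrt (2 * M * α) with hK
  have hKpos : 0 < K := Real.sqrt_pos.2 (by positivity)
  have hle : ∀ x ∈ Ioo e bR,
      ENNReal.ofReal K⁻¹ * ENNReal.ofReal ((bR - x)⁻¹) ≤ h f ((α ^ 2)⁻¹) x := by
    intro x hx
    have hx' : x ∈ Ico e bR := ⟨hx.1.le, hx.2⟩
    have hfx := hfpos x (hmem x hx')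
    have hGx := hG x ((le_max_left _ _).trans_lt hx.1) hx.2
    have hbx : 0 < bR - x := sub_pos.2 hx.2
    have h2 := b2 x hx'
    have hs : 0 < Real.sqrt (G f x - (α ^ 2)⁻¹) := Real.sqrt_pos.2 (sub_pos.2 hGx)
    unfold h
    rw [← ENNReal.ofReal_mul (inv_nonneg.2 hKpos.le), ← mul_inv]
    apply ENNReal.ofReal_le_ofReal
    apply inv_anti₀ (by positivity)
    have hfa : f x < α := by
      unfold G at hGx
      have := (inv_lt_inv₀ (by positivity) (by positivity)).1 hGx
      exact lt_of_pow_lt_pow_left₀ 2 hα.le this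
    rw [abs_of_pos (sub_pos.2 hfa)] at h2
    have e1 : f x ^ 2 * Real.sqrt (G f x - (α ^ 2)⁻¹)
        = Real.sqrt ((f x ^ 2) ^ 2 * (G f x - (α ^ 2)⁻¹)) := by
      rw [Real.sqrt_mul (by positivity), Real.sqrt_sq (by positivity)]
    have e2 : K * (bR - x) = Real.sqrt (2 * M * α * (bR - x) ^ 2) := by
      rw [Real.sqrt_mul (by positivity), Real.sqrt_sq hbx.le]
    rw [e1, e2]
    apply Real.sqrt_le_sqrt
    have e3 : (f x ^ 2) ^ 2 * (G f x - (α ^ 2)⁻¹)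
        = (f x ^ 2 / α ^ 2) * ((α - f x) * (α + f x)) := by
      unfold G; field_simp; ring
    have e4 : f x ^ 2 / α ^ 2 ≤ 1 := by
      rw [div_le_one (by positivity)]; gcongr
    have e5 : 0 ≤ (α - f x) * (α + f x) := mul_nonneg (by linarith) (by linarith)
    calc _ = _ := e3
      _ ≤ 1 * ((α - f x) * (α + f x)) := mul_le_mul_of_nonneg_right e4 e5
      _ ≤ (M * (bR - x) ^ 2) * (2 * α) := by
        rw [one_mul]
        exact mul_le_mul h2 (by linarith) (by linarith) (by positivity)
      _ = _ := by ring
  rw [eq_top_iff]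
  calc (⊤ : ℝ≥0∞) = ENNReal.ofReal K⁻¹ * ∫⁻ τ in Ioo e bR, ENNReal.ofReal ((bR - τ)⁻¹) := by
        rw [flat_div e bR heb, ENNReal.mul_top]
        simpa using hKpos
    _ = ∫⁻ τ in Ioo e bR, ENNReal.ofReal K⁻¹ * ENNReal.ofReal ((bR - τ)⁻¹) := by
        rw [lintegral_const_mul' _ _ ENNReal.ofReal_ne_top]
    _ ≤ ∫⁻ τ in Ioo e bR, h f ((α ^ 2)⁻¹) τ := setLIntegral_mono' measurableSet_Ioo hle
    _ ≤ _ := lintegral_mono_set (Ioo_subset_Ioo_left (le_max_left _ _))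
end
end
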